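/- arXiv:2601.22401 — 9 statements merged into one kernel-verified Lean document; each statement's English description precedes it below -/
import Mathlib

section
/- Let (a_n)_{n≥1} be a strictly increasing sequence of positive integers satisfying liminf_{n→∞} a_n^{1/2^n} > 1. Then the series S = ∑_{n=1}^∞ 1/(a_n · a_{n+1}) converges to an irrational number. -/
open Finset in
/-- Tails of `∑ 1 / (a k * a (k + 1))` are dominated by a telescoping series. -/
lemma sum_range_one_div_mul_succ_le (a : ℕ → ℕ) (ha : StrictMono a) (hpos : ∀ n, 0 < a n)
    (m n : ℕ) :
    ∑ k ∈ range n, 1 / ((a (k + m) : ℝ) * (a (k + m + 1) : ℝ)) ≤ 1 / a m - 1 / a (n + m) := by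
  induction n with
  | zero => simp
  | succ n ih =>
    rw [sum_range_succ]
    have h1 : (0 : ℝ) < a (n + m) := by exact_mod_cast hpos _
    have h2 : (a (n + m) : ℝ) + 1 ≤ a (n + m + 1) := by
      exact_mod_cast ha (Nat.lt_succ_self (n + m))
    have h3 : 1 / ((a (n + m) : ℝ) * (a (n + m + 1) : ℝ))
        ≤ 1 / a (n + m) - 1 / a (n + m + 1) := by
      rw [div_sub_div _ _ (by positivity) (by linarith)]
      gcongr
      linarith
    rw [show n + 1 + m = n + m + 1 by ring]
    linarith

lemma summable_one_div_mul_succ (a : ℕ → ℕ) (ha : StrictMono a) (hpos : ∀ n, 0 < a n) (m : ℕ) :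
    Summable fun k : ℕ => 1 / ((a (k + m) : ℝ) * (a (k + m + 1) : ℝ)) :=
  summable_of_sum_range_le (c := 1 / a m) (fun _ => by positivity) fun n =>
    (sum_range_one_div_mul_succ_le a ha hpos m n).trans (sub_le_self _ (by positivity))

lemma tsum_one_div_mul_succ_le (a : ℕ → ℕ) (ha : StrictMono a) (hpos : ∀ n, 0 < a n) (m : ℕ) :
    ∑' k : ℕ, 1 / ((a (k + m) : ℝ) * (a (k + m + 1) : ℝ)) ≤ 1 / a m :=
  Real.tsum_le_of_sum_range_le (fun _ => by positivity) fun n =>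
    (sum_range_one_div_mul_succ_le a ha hpos m n).trans (sub_le_self _ (by positivity))

open Finset in
/-- If `a (m + J)` exceeds `a m ^ 2`, the tail from `m` is of order `1 / a m ^ 2`. -/
lemma tsum_one_div_mul_succ_le_div_sq (a : ℕ → ℕ) (ha : StrictMono a) (hpos : ∀ n, 0 < a n)
    (m J : ℕ) (hJ : (a m : ℝ) ^ 2 ≤ a (m + J)) :
    ∑' k : ℕ, 1 / ((a (k + m) : ℝ) * (a (k + m + 1) : ℝ)) ≤ (J + 1) / (a m : ℝ) ^ 2 := by
  have hm : (0 : ℝ) < a m := by exact_mod_cast hpos _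
  have hmono : ∀ k, m ≤ k → (a m : ℝ) ≤ a k := fun k hk => by exact_mod_cast ha.monotone hk
  rw [← (summable_one_div_mul_succ a ha hpos m).sum_add_tsum_nat_add J]
  have h1 : ∑ k ∈ range J, 1 / ((a (k + m) : ℝ) * (a (k + m + 1) : ℝ))
      ≤ ∑ k ∈ range J, 1 / (a m : ℝ) ^ 2 := by
    refine sum_le_sum fun k _ => ?_
    rw [sq]
    exact one_div_le_one_div_of_le (mul_pos hm hm) (mul_le_mul (hmono _ (by omega))
      (hmono _ (by omega)) hm.le (Nat.cast_nonneg _))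
  have h2 := tsum_one_div_mul_succ_le a ha hpos (m + J)
  have h3 : (1 : ℝ) / a (m + J) ≤ 1 / (a m : ℝ) ^ 2 := by gcongr
  simp only [sum_const, card_range, nsmul_eq_mul] at h1
  simp only [show ∀ k, k + J + m = k + (m + J) from fun k => by ring]
  rw [add_div, div_eq_mul_one_div (J : ℝ)]
  linarith

open Finset in
lemma exists_sum_range_eq_div_prod (a : ℕ → ℕ) (hpos : ∀ n, 0 < a n) (n : ℕ) :
    ∃ N : ℕ, ∑ k ∈ range n, 1 / ((a k : ℝ) * (a (k + 1) : ℝ))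
      = N / ∏ k ∈ range (n + 1), (a k : ℝ) := by
  have h : ∀ k, (a k : ℝ) ≠ 0 := fun k => by exact_mod_cast (hpos k).ne'
  induction n with
  | zero => exact ⟨0, by simp⟩
  | succ n ih =>
    obtain ⟨N, hN⟩ := ih
    refine ⟨N * a (n + 1) + ∏ k ∈ range n, a k, ?_⟩
    have hP : ∏ k ∈ range n, (a k : ℝ) ≠ 0 := prod_ne_zero_iff.2 fun k _ => h k
    have h1 := h n
    have h2 := h (n + 1)
    rw [sum_range_succ, hN, prod_range_succ _ (n + 1), prod_range_succ _ n]
    push_cast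
    field_simp

open Finset in
/-- A rational value forces the tails, scaled by the partial products, to stay away from `0`. -/
lemma one_le_of_tsum_eq_rat (a : ℕ → ℕ) (ha : StrictMono a) (hpos : ∀ n, 0 < a n) (r : ℚ)
    (hr : (r : ℝ) = ∑' n : ℕ, 1 / ((a n : ℝ) * (a (n + 1) : ℝ))) (n : ℕ) :
    1 ≤ (r.den : ℝ) * ((∏ k ∈ range n, (a k : ℝ)) / a (n + 1) +
      (∏ k ∈ range (n + 1), (a k : ℝ)) *
        ∑' k : ℕ, 1 / ((a (k + (n + 1)) : ℝ) * (a (k + (n + 1) + 1) : ℝ))) := by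
  have h : ∀ k, (0 : ℝ) < a k := fun k => by exact_mod_cast hpos k
  obtain ⟨N, hN⟩ := exists_sum_range_eq_div_prod a hpos n
  set T := ∑' k : ℕ, 1 / ((a (k + (n + 1)) : ℝ) * (a (k + (n + 1) + 1) : ℝ)) with hT
  have hsplit := (summable_one_div_mul_succ a ha hpos 0).sum_add_tsum_nat_add (n + 1)
  simp only [add_zero] at hsplit
  rw [sum_range_succ, hN, ← hr, ← hT] at hsplit
  have hT0 : 0 ≤ T := tsum_nonneg fun _ => by positivity
  have hP : 0 < ∏ k ∈ range n, (a k : ℝ) := prod_pos fun k _ => h k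
  have h1 := h n
  have h2 := h (n + 1)
  have hd : (0 : ℝ) < r.den := by exact_mod_cast r.pos
  have hnum : (r.den : ℝ) * r = r.num := by exact_mod_cast r.den_mul_eq_num
  have key : (r.den : ℝ) * ((∏ k ∈ range n, (a k : ℝ)) / a (n + 1) +
      (∏ k ∈ range (n + 1), (a k : ℝ)) * T)
      = ((r.num * (∏ k ∈ range (n + 1), a k : ℕ) - r.den * N : ℤ) : ℝ) := by
    push_cast
    rw [← hnum, ← hsplit, prod_range_succ]
    field_simp
    ring
  have hpos' : 0 < (r.den : ℝ) * ((∏ k ∈ range n, (a k : ℝ)) / a (n + 1) +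
      (∏ k ∈ range (n + 1), (a k : ℝ)) * T) := by
    have : 0 < ∏ k ∈ range (n + 1), (a k : ℝ) := prod_pos fun k _ => h k
    positivity
  rw [key] at hpos' ⊢
  exact_mod_cast hpos'

open Finset in
lemma sum_range_le_of_le_mul_two_pow (f : ℕ → ℝ) (t : ℝ) (K m : ℕ) (hKm : K ≤ m)
    (h : ∀ k, K ≤ k → k < m → f k ≤ t * 2 ^ k) :
    ∑ k ∈ range m, f k ≤ ∑ k ∈ range K, f k + t * (2 ^ m - 2 ^ K) := by
  induction m, hKm using Nat.le_induction with
  | base => simp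
  | succ m hm ih =>
    rw [sum_range_succ, pow_succ]
    have h1 := ih fun k hk hkm => h k hk (by omega)
    have h2 := h m hm (by omega)
    linarith

open Finset in
lemma prod_range_eq_exp_sum_log (a : ℕ → ℕ) (hpos : ∀ n, 0 < a n) (m : ℕ) :
    ∏ k ∈ range m, (a k : ℝ) = Real.exp (∑ k ∈ range m, Real.log (a k)) := by
  rw [Real.exp_sum]
  exact prod_congr rfl fun k _ => (Real.exp_log (by exact_mod_cast hpos k)).symm

open Finset in
/-- If `log (a n) / 2 ^ n` is unbounded, the scaled tails become arbitrarily small at the indices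
where it exceeds all of its previous values. -/
lemma exists_scaled_tail_lt_of_unbounded (a : ℕ → ℕ) (ha : StrictMono a) (hpos : ∀ n, 0 < a n)
    (hb : ¬ BddAbove (Set.range fun n => Real.log (a n) / 2 ^ n)) (ε : ℝ) (hε : 0 < ε) :
    ∃ n, (∏ k ∈ range n, (a k : ℝ)) / a (n + 1) + (∏ k ∈ range (n + 1), (a k : ℝ)) *
      ∑' k : ℕ, 1 / ((a (k + (n + 1)) : ℝ) * (a (k + (n + 1) + 1) : ℝ)) < ε := by
  have h : ∀ k, (0 : ℝ) < a k := fun k => by exact_mod_cast hpos k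
  have h1 : ∀ k, (1 : ℝ) ≤ a k := fun k => by exact_mod_cast hpos k
  set M := max (-Real.log (ε / 2)) (Real.log (a 0)) with hM
  have hex : ∃ m, M < Real.log (a m) / 2 ^ m := by
    simpa [bddAbove_def] using not_bddAbove_iff.1 hb M
  classical
  obtain ⟨m, hm, hmin⟩ : ∃ m, M < Real.log (a m) / 2 ^ m ∧
      ∀ k < m, Real.log (a k) / 2 ^ k ≤ M :=
    ⟨Nat.find hex, Nat.find_spec hex, fun k hk => not_lt.1 (Nat.find_min hex hk)⟩
  obtain _ | n := m
  · have := le_max_right (-Real.log (ε / 2)) (Real.log (a 0))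
    simp only [pow_zero, div_one] at hm
    linarith
  refine ⟨n, ?_⟩
  set P := ∏ k ∈ range (n + 1), (a k : ℝ) with hP
  have hPn : ∏ k ∈ range n, (a k : ℝ) ≤ P := by
    rw [hP, prod_range_succ]
    exact le_mul_of_one_le_right (prod_nonneg fun k _ => (h k).le) (h1 n)
  have hP0 : 0 < P := prod_pos fun k _ => h k
  have hlog := sum_range_le_of_le_mul_two_pow (fun k => Real.log (a k)) M 0 (n + 1)
    (Nat.zero_le _) fun k _ hk => (div_le_iff₀ (by positivity)).1 (hmin k hk)
  rw [lt_div_iff₀ (by positivity)] at hm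
  simp only [range_zero, sum_empty, zero_add, pow_zero] at hlog
  have hMε : -Real.log (ε / 2) ≤ M := le_max_left _ _
  have hsmall : P / a (n + 1) < ε / 2 := by
    rw [hP, prod_range_eq_exp_sum_log a hpos, ← Real.exp_log (h (n + 1)), ← Real.exp_sub,
      ← Real.lt_log_iff_exp_lt (by positivity)]
    linarith
  have htail := tsum_one_div_mul_succ_le a ha hpos (n + 1)
  calc _ ≤ P / a (n + 1) + P * (1 / a (n + 1)) := by
        gcongr
    _ < ε := by rw [mul_one_div]; linarith

open Filter Finset in
/-- If `log (a n) / 2 ^ n` is bounded and bounded below by a positive constant, the scaled tails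
become arbitrarily small at the indices where it is close to its limit superior. -/
lemma exists_scaled_tail_lt_of_bounded (a : ℕ → ℕ) (ha : StrictMono a) (hpos : ∀ n, 0 < a n)
    (hb : BddAbove (Set.range fun n => Real.log (a n) / 2 ^ n)) (δ : ℝ) (hδ : 0 < δ)
    (hlow : ∀ᶠ n in atTop, δ ≤ Real.log (a n) / 2 ^ n) (ε : ℝ) (hε : 0 < ε) :
    ∃ n, (∏ k ∈ range n, (a k : ℝ)) / a (n + 1) + (∏ k ∈ range (n + 1), (a k : ℝ)) *
      ∑' k : ℕ, 1 / ((a (k + (n + 1)) : ℝ) * (a (k + (n + 1) + 1) : ℝ)) < ε := by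
  have h : ∀ k, (0 : ℝ) < a k := fun k => by exact_mod_cast hpos k
  obtain ⟨B, hB⟩ := hb
  replace hB : ∀ n, Real.log (a n) ≤ B * 2 ^ n := fun n =>
    (div_le_iff₀ (by positivity)).1 (hB ⟨n, rfl⟩)
  set b : ℕ → ℝ := fun n => Real.log (a n) / 2 ^ n with hbdef
  have hbu : IsBoundedUnder (· ≤ ·) atTop b :=
    isBoundedUnder_of ⟨B, fun n => (div_le_iff₀ (by positivity)).2 (hB n)⟩
  have hcb : IsCoboundedUnder (· ≤ ·) atTop b :=
    IsBoundedUnder.isCoboundedUnder_le ⟨δ, by simpa [eventually_map] using hlow⟩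
  set s := limsup b atTop with hs
  have hs0 : 0 < s := hδ.trans_le (le_limsup_of_frequently_le hlow.frequently hbu)
  have hup : ∀ᶠ n in atTop, b n < 11 / 10 * s :=
    eventually_lt_of_limsup_lt (by rw [← hs]; linarith) hbu
  have hfreq : ∃ᶠ n in atTop, 9 / 10 * s < b n :=
    frequently_lt_of_lt_limsup hcb (by rw [← hs]; linarith)
  obtain ⟨K, hK⟩ := eventually_atTop.1 (hup.and hlow)
  obtain ⟨J, hJ⟩ := pow_unbounded_of_one_lt (2 * B / δ) (one_lt_two : (1 : ℝ) < 2)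
  rw [div_lt_iff₀ hδ] at hJ
  set C := ∑ k ∈ range K, Real.log (a k) with hC
  have hlogtop : Tendsto (fun n => Real.log (a n)) atTop atTop :=
    Real.tendsto_log_atTop.comp (tendsto_natCast_atTop_atTop.comp ha.tendsto_atTop)
  obtain ⟨m, hm, hmK, hmL⟩ := (hfreq.and_eventually ((eventually_ge_atTop (K + 1)).and
    (hlogtop.eventually_gt_atTop (3 * (C - Real.log (ε / (J + 2))))))).exists
  obtain ⟨n, rfl⟩ : ∃ n, m = n + 1 := ⟨m - 1, by omega⟩
  refine ⟨n, ?_⟩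
  set L := Real.log (a (n + 1)) with hL
  have hprod : ∀ m, K ≤ m → ∑ k ∈ range m, Real.log (a k) ≤ C + 11 / 10 * s * 2 ^ m := by
    intro m hm
    have := sum_range_le_of_le_mul_two_pow (fun k => Real.log (a k)) (11 / 10 * s) K m hm
      fun k hk _ => ((div_lt_iff₀ (by positivity)).1 (hK k hk).1).le
    have h2 : 0 ≤ 11 / 10 * s * 2 ^ K := by positivity
    linarith
  have hp1 := hprod (n + 1) (by omega)
  have hp0 := hprod n (by omega)
  have hmL' : 9 / 10 * s * 2 ^ (n + 1) < L := (lt_div_iff₀ (by positivity)).1 hm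
  rw [pow_succ] at hp1 hmL'
  have hL0 : 0 < L := lt_trans (by positivity) hmL'
  have hsq : (a (n + 1) : ℝ) ^ 2 ≤ a (n + 1 + J) := by
    rw [← Real.log_le_log_iff (pow_pos (h _) 2) (h _), Real.log_pow]
    have h1 := (le_div_iff₀ (by positivity)).1 (hK (n + 1 + J) (by omega)).2
    have h2 := hB (n + 1)
    have h3 : 2 * B * 2 ^ (n + 1) ≤ 2 ^ J * δ * 2 ^ (n + 1) := by gcongr
    rw [pow_add] at h1
    push_cast
    linarith
  have htail := tsum_one_div_mul_succ_le_div_sq a ha hpos (n + 1) J hsq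
  have hexp : Real.exp (C - L / 3) < ε / (J + 2) := by
    rw [← Real.lt_log_iff_exp_lt (by positivity)]
    linarith
  have hA : (∏ k ∈ range n, (a k : ℝ)) / a (n + 1) ≤ Real.exp (C - L / 3) := by
    rw [prod_range_eq_exp_sum_log a hpos, ← Real.exp_log (h (n + 1)), ← Real.exp_sub]
    exact Real.exp_le_exp.2 (by linarith)
  have hD : (∏ k ∈ range (n + 1), (a k : ℝ)) / (a (n + 1) : ℝ) ^ 2 ≤ Real.exp (C - L / 3) := by
    rw [prod_range_eq_exp_sum_log a hpos, ← Real.exp_log (pow_pos (h (n + 1)) 2), ← Real.exp_sub,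
      Real.log_pow]
    refine Real.exp_le_exp.2 ?_
    push_cast
    linarith
  have hP0 : 0 ≤ ∏ k ∈ range (n + 1), (a k : ℝ) := prod_nonneg fun k _ => (h k).le
  calc _ ≤ (∏ k ∈ range n, (a k : ℝ)) / a (n + 1) +
        (∏ k ∈ range (n + 1), (a k : ℝ)) * ((J + 1) / (a (n + 1) : ℝ) ^ 2) := by gcongr
    _ = (∏ k ∈ range n, (a k : ℝ)) / a (n + 1) +
        (J + 1) * ((∏ k ∈ range (n + 1), (a k : ℝ)) / (a (n + 1) : ℝ) ^ 2) := by ring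
    _ ≤ Real.exp (C - L / 3) + (J + 1) * Real.exp (C - L / 3) := by gcongr
    _ = (J + 2) * Real.exp (C - L / 3) := by ring
    _ < (J + 2) * (ε / (J + 2)) := by gcongr
    _ = ε := by field_simp

open Filter in
lemma exists_pos_eventually_le_log_div (a : ℕ → ℕ) (hpos : ∀ n, 0 < a n)
    (hliminf : 1 < liminf (fun n : ℕ => (a n : ℝ) ^ ((1 : ℝ) / 2 ^ (n + 1))) atTop) :
    ∃ δ > 0, ∀ᶠ n in atTop, δ ≤ Real.log (a n) / 2 ^ n := by
  obtain ⟨c, hc1, hc⟩ := exists_between hliminf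
  have hev := eventually_lt_of_lt_liminf hc
    (isBoundedUnder_of ⟨0, fun n => by positivity⟩)
  refine ⟨Real.log c, Real.log_pos hc1, hev.mono fun n hn => ?_⟩
  have h0 : (0 : ℝ) < a n := by exact_mod_cast hpos n
  have h1 : (1 : ℝ) ≤ a n := by exact_mod_cast hpos n
  have hlog := Real.log_le_log (by linarith) hn.le
  rw [Real.log_rpow h0, one_div_mul_eq_div] at hlog
  refine hlog.trans ?_
  have := Real.log_nonneg h1
  gcongr
  · norm_num
  · omega


/-- Let `(a_n)_{n ≥ 1}` be a strictly increasing sequence of positive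
integers with `liminf_{n → ∞} a_n ^ (1 / 2^n) > 1`.  Then
`S = ∑_{n=1}^∞ 1 / (a_n * a_{n+1})` is irrational.
Here `a n` denotes `a_{n+1}`, so the exponent for `a n` is `1 / 2 ^ (n + 1)`. -/
theorem stmt0 (a : ℕ → ℕ) (ha : StrictMono a) (hpos : ∀ n, 0 < a n)
    (hliminf :
      1 < Filter.liminf (fun n : ℕ => (a n : ℝ) ^ ((1 : ℝ) / 2 ^ (n + 1))) Filter.atTop) :
    Irrational (∑' n : ℕ, 1 / ((a n : ℝ) * (a (n + 1) : ℝ))) := by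
  rintro ⟨r, hr⟩
  obtain ⟨δ, hδ, hlow⟩ := exists_pos_eventually_le_log_div a hpos hliminf
  have hd : (0 : ℝ) < r.den := by exact_mod_cast r.pos
  have hε : (0 : ℝ) < 1 / r.den := by positivity
  obtain ⟨n, hn⟩ := (em (BddAbove (Set.range fun n => Real.log (a n) / 2 ^ n))).elim
    (fun hb => exists_scaled_tail_lt_of_bounded a ha hpos hb δ hδ hlow _ hε)
    (fun hb => exists_scaled_tail_lt_of_unbounded a ha hpos hb _ hε)
  rw [lt_div_iff₀' hd] at hn
  exact (one_le_of_tsum_eq_rat a ha hpos r hr n).not_gt hn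
end

section
/- For all integers k ≥ 10 and j ≥ 10, the integer 3^{2k} + 2^{2j} is not a perfect square; equivalently, there is no integer z with z² = 9^k + 4^j. Consequently, the real number √(9^k + 4^j) is irrational. -/
/-- The only `k` for which `3 ^ (2 * k) - 1` is a power of two are `k ≤ 1`. -/
theorem three_pow_two_mul_ne_two_pow_add_one {k : ℕ} (hk : 2 ≤ k) (m : ℕ) :
    3 ^ (2 * k) ≠ 2 ^ m + 1 := by
  intro h
  have h9 : 3 ^ 2 ≤ 3 ^ k := Nat.pow_le_pow_right (by norm_num) hk
  obtain ⟨x, hx⟩ : ∃ x, 3 ^ k = x + 1 := ⟨3 ^ k - 1, by omega⟩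
  have hprod : x * (x + 2) = 2 ^ m := by
    have : (x + 1) ^ 2 = 2 ^ m + 1 := by rw [← hx, ← pow_mul, mul_comm k 2, h]
    nlinarith
  obtain ⟨a, -, ha⟩ := (Nat.dvd_prime_pow Nat.prime_two).1 (Dvd.intro _ hprod)
  obtain ⟨b, -, hb⟩ := (Nat.dvd_prime_pow Nat.prime_two).1 (Dvd.intro_left _ hprod)
  have ha2 : 2 ≤ a := by
    by_contra! hlt
    have : 2 ^ a ≤ 2 ^ 1 := Nat.pow_le_pow_right (by norm_num) (by omega)
    omega
  have hb2 : 2 ≤ b := by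
    by_contra! hlt
    have : 2 ^ b ≤ 2 ^ 1 := Nat.pow_le_pow_right (by norm_num) (by omega)
    omega
  have h4a : 2 ^ 2 ∣ 2 ^ a := pow_dvd_pow 2 ha2
  have h4b : 2 ^ 2 ∣ 2 ^ b := pow_dvd_pow 2 hb2
  omega

theorem sq_ne_three_pow_add_two_pow {k : ℕ} (hk : 2 ≤ k) (j n : ℕ) :
    n ^ 2 ≠ 3 ^ (2 * k) + 2 ^ (2 * j) := by
  intro h
  have hlt : 2 ^ j < n := by
    refine lt_of_pow_lt_pow_left₀ 2 (Nat.zero_le n) ?_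
    rw [h, ← pow_mul, mul_comm j 2]
    exact Nat.lt_add_of_pos_left (by positivity)
  obtain ⟨x, rfl⟩ := Nat.exists_eq_add_of_lt hlt
  have hprod : (x + 1) * (x + 1 + 2 ^ (j + 1)) = 3 ^ (2 * k) := by
    rw [mul_comm 2 j, pow_mul 2 j 2] at h
    rw [pow_succ]
    nlinarith
  obtain ⟨a, -, ha⟩ := (Nat.dvd_prime_pow Nat.prime_three).1 (Dvd.intro _ hprod)
  obtain ⟨b, -, hb⟩ := (Nat.dvd_prime_pow Nat.prime_three).1 (Dvd.intro_left _ hprod)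
  have hpos : 0 < 2 ^ (j + 1) := by positivity
  have hb0 : b ≠ 0 := by
    rintro rfl
    omega
  have ha0 : a = 0 := by
    by_contra ha0
    have h3a : 3 ∣ x + 1 := ha ▸ dvd_pow_self 3 ha0
    have h3b : 3 ∣ x + 1 + 2 ^ (j + 1) := hb ▸ dvd_pow_self 3 hb0
    have h32 : 3 ∣ 2 := Nat.prime_three.dvd_of_dvd_pow ((Nat.dvd_add_right h3a).1 h3b)
    omega
  rw [ha, ha0, pow_zero, one_mul, add_comm] at hprod
  exact three_pow_two_mul_ne_two_pow_add_one hk _ hprod.symm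


/-- For all integers `k ≥ 10`, `j ≥ 10`, the integer `3^{2k} + 2^{2j}`
is not a perfect square — equivalently there is no integer `z` with `z² = 9^k + 4^j` —
and consequently `√(9^k + 4^j)` is irrational. -/
theorem stmt6 (k j : ℕ) (hk : 10 ≤ k) (hj : 10 ≤ j) :
    (¬ ∃ z : ℤ, z ^ 2 = 3 ^ (2 * k) + 2 ^ (2 * j)) ∧
    (¬ ∃ z : ℤ, z ^ 2 = 9 ^ k + 4 ^ j) ∧
    Irrational (Real.sqrt ((9 : ℝ) ^ k + (4 : ℝ) ^ j)) := by
  have hsq : ¬ ∃ z : ℤ, z ^ 2 = 3 ^ (2 * k) + 2 ^ (2 * j) := by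
    rintro ⟨z, hz⟩
    refine sq_ne_three_pow_add_two_pow (by omega : 2 ≤ k) j z.natAbs ?_
    zify
    rw [sq_abs, hz]
  have hsq' : ¬ ∃ z : ℤ, z ^ 2 = 9 ^ k + 4 ^ j := by
    simpa [pow_mul] using hsq
  refine ⟨hsq, hsq', ?_⟩
  have hirr : Irrational (Real.sqrt ((9 ^ k + 4 ^ j : ℕ) : ℝ)) := by
    rw [irrational_sqrt_natCast_iff]
    rintro ⟨n, hn⟩
    exact hsq' ⟨n, by rw [sq]; exact_mod_cast hn.symm⟩
  simpa using hirr
end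

section
/- For every prime p with p ≡ 5 (mod 8), there exists a positive integer k such that p² divides x_k² + 1; equivalently, setting n_k = 8·y_k², one has n_k + 2 ≡ 0 (mod p²). -/
/-- In `ℤ√2`, the powers of `(1 + √2)² = 3 + √8` have coordinates `x k` and `2 y k`. -/
theorem Zsqrtd.one_one_pow_two_mul (x y : ℕ → ℤ)
    (hx0 : x 0 = 1) (hx1 : x 1 = 3) (hxrec : ∀ k, x (k + 2) = 6 * x (k + 1) - x k)
    (hy0 : y 0 = 0) (hy1 : y 1 = 1) (hyrec : ∀ k, y (k + 2) = 6 * y (k + 1) - y k) (k : ℕ) :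
    (⟨1, 1⟩ : ℤ√2) ^ (2 * k) = ⟨x k, 2 * y k⟩ := by
  have step (k : ℕ) : x (k + 1) = 3 * x k + 8 * y k ∧ y (k + 1) = x k + 3 * y k := by
    induction k with
    | zero => simp [hx0, hx1, hy0, hy1]
    | succ k ih =>
      rw [hxrec, hyrec]
      constructor <;> linarith [ih.1, ih.2]
  induction k with
  | zero => ext <;> simp [hx0, hy0]
  | succ k ih =>
    rw [mul_add, pow_add, ih, (step k).1, (step k).2]
    ext <;> simp [sq] <;> ring

/-- If `p` is a prime congruent to `5` modulo `8`, then `2 ^ ((p - 1) / 2) ≡ -1` modulo `p`. -/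
theorem Nat.Prime.dvd_two_pow_half_add_one {p : ℕ} (hp : p.Prime) (hp5 : p % 8 = 5) :
    (p : ℤ) ∣ 2 ^ (p / 2) + 1 := by
  have := Fact.mk hp
  have h2 : (2 : ZMod p) ≠ 0 := fun h => by
    have h' : ((2 : ℕ) : ZMod p) = 0 := by exact_mod_cast h
    have := Nat.le_of_dvd two_pos ((ZMod.natCast_eq_zero_iff 2 p).1 h')
    omega
  have hns : ¬ IsSquare (2 : ZMod p) := by
    rw [ZMod.exists_sq_eq_two_iff (by omega)]
    omega
  rw [ZMod.euler_criterion p h2] at hns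
  have h := (ZMod.pow_div_two_eq_neg_one_or_one p h2).resolve_left hns
  rw [← ZMod.intCast_zmod_eq_zero_iff_dvd]
  push_cast
  rw [h]
  ring

/-- If `p` is a prime congruent to `5` modulo `8`, then `p` is inert in `ℤ√2` and the Frobenius
sends the unit `1 + √2` to its conjugate, whose product with it is `-1`. -/
theorem Zsqrtd.dvd_one_one_pow_succ_add_one {p : ℕ} (hp : p.Prime) (hp5 : p % 8 = 5) :
    (p : ℤ√2) ∣ ⟨1, 1⟩ ^ (p + 1) + 1 := by
  obtain ⟨c, hc⟩ := hp.dvd_two_pow_half_add_one hp5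
  obtain ⟨r, hr⟩ := exists_add_pow_prime_eq hp (1 : ℤ√2) Zsqrtd.sqrtd
  have hu : (⟨1, 1⟩ : ℤ√2) = 1 + Zsqrtd.sqrtd := by ext <;> simp
  have hs : (Zsqrtd.sqrtd : ℤ√2) * Zsqrtd.sqrtd = 2 := by ext <;> simp
  have hc' : (2 : ℤ√2) ^ (p / 2) = p * c - 1 := by
    rw [eq_sub_iff_add_eq]
    simpa using congrArg (Int.cast : ℤ → ℤ√2) hc
  have hsp : (Zsqrtd.sqrtd : ℤ√2) ^ p = ((p : ℤ√2) * (c : ℤ√2) - 1) * Zsqrtd.sqrtd := by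
    calc (Zsqrtd.sqrtd : ℤ√2) ^ p = Zsqrtd.sqrtd ^ (2 * (p / 2) + 1) := by congr 1; omega
      _ = _ := by rw [pow_succ, pow_mul, sq, hs, hc']
  rw [hu, pow_succ, hr, hsp, one_pow]
  exact ⟨((c : ℤ√2) * Zsqrtd.sqrtd + Zsqrtd.sqrtd * r) * (1 + Zsqrtd.sqrtd), by linear_combination -hs⟩

/-- Define sequences `(x_k)`, `(y_k)` by `x_0 = 1`, `x_1 = 3`,
`x_{k+1} = 6 x_k - x_{k-1}` and `y_0 = 0`, `y_1 = 1`, `y_{k+1} = 6 y_k - y_{k-1}`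
(equivalently `x_k + y_k √8 = (3 + √8)^k`, so `x_k² - 8 y_k² = 1`).  For every prime
`p ≡ 5 (mod 8)` there is a positive integer `k` with `p² ∣ x_k² + 1`; equivalently,
with `n_k = 8 y_k²`, one has `n_k + 2 ≡ 0 (mod p²)`. -/
theorem stmt8 (x y : ℕ → ℤ)
    (hx0 : x 0 = 1) (hx1 : x 1 = 3) (hxrec : ∀ k, x (k + 2) = 6 * x (k + 1) - x k)
    (hy0 : y 0 = 0) (hy1 : y 1 = 1) (hyrec : ∀ k, y (k + 2) = 6 * y (k + 1) - y k)
    (p : ℕ) (hp : p.Prime) (hp5 : p % 8 = 5) :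
    ∃ k : ℕ, 0 < k ∧ (p : ℤ) ^ 2 ∣ x k ^ 2 + 1 ∧ (p : ℤ) ^ 2 ∣ 8 * y k ^ 2 + 2 := by
  have hodd : Odd p := Nat.odd_iff.2 (by omega)
  obtain ⟨k, hk0, hk⟩ : ∃ k, 0 < k ∧ 2 * k * 2 = (p + 1) * p + 2 := by
    obtain ⟨t, rfl⟩ : ∃ t, p = 8 * t + 5 := ⟨p / 8, by omega⟩
    exact ⟨16 * t ^ 2 + 22 * t + 8, by positivity, by ring⟩
  have hpow := Zsqrtd.one_one_pow_two_mul x y hx0 hx1 hxrec hy0 hy1 hyrec k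
  have hpell : x k ^ 2 - 8 * y k ^ 2 = 1 := by
    have h : Zsqrtd.norm ((⟨1, 1⟩ : ℤ√2) ^ (2 * k)) = 1 := by
      change Zsqrtd.normMonoidHom _ = 1
      rw [map_pow, pow_mul]
      simp [Zsqrtd.normMonoidHom, Zsqrtd.norm]
    rw [hpow, Zsqrtd.norm_def] at h
    linear_combination h
  have hdvd : ((p : ℤ√2)) ^ 2 ∣ (⟨1, 1⟩ ^ (p + 1)) ^ p + 1 := by
    have h := dvd_sub_pow_of_dvd_sub (a := (⟨1, 1⟩ : ℤ√2) ^ (p + 1)) (b := -1) (p := p)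
      (by simpa using Zsqrtd.dvd_one_one_pow_succ_add_one hp hp5) 1
    simpa [hodd.neg_one_pow] using h
  have hre : (p : ℤ) ^ 2 ∣ 2 * (x k ^ 2 + 1) := by
    have h : (((p : ℤ) ^ 2 : ℤ) : ℤ√2) ∣ ⟨x k, 2 * y k⟩ ^ 2 + ⟨1, 1⟩ ^ 2 := by
      rw [← hpow, ← pow_mul, hk, pow_add, pow_mul, ← add_one_mul]
      push_cast
      exact hdvd.mul_right _
    have h' := ((Zsqrtd.intCast_dvd _ _).1 h).1
    simp only [sq (⟨_, _⟩ : ℤ√2), Zsqrtd.re_add, Zsqrtd.re_mul] at h'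
    convert h' using 1
    linear_combination hpell
  have hcop : IsCoprime ((p : ℤ) ^ 2) 2 :=
    IsCoprime.pow_left (by exact_mod_cast Nat.isCoprime_iff_coprime.2 hodd.coprime_two_right)
  have hx := hcop.dvd_of_dvd_mul_left hre
  refine ⟨k, hk0, hx, ?_⟩
  rwa [show 8 * y k ^ 2 + 2 = x k ^ 2 + 1 by linear_combination -hpell]
end

section
/- No three distinct points of the lattice Λ form an equilateral triangle in ℝ². -/
/-- The lattice `Λ ⊂ ℝ²` of all points `m (1, 0) + k (1/2, √7/2)` with `m, k ∈ ℤ`. -/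
def LambdaLat : Set (EuclideanSpace ℝ (Fin 2)) :=
  {u | ∃ m k : ℤ, u = ![(m : ℝ) + (k : ℝ) / 2, (k : ℝ) * Real.sqrt 7 / 2]}

theorem Int.eq_zero_of_three_mul_sq_eq_seven_mul_sq {n d : ℤ} (h : 3 * n ^ 2 = 7 * d ^ 2) :
    n = 0 := by
  by_contra hn
  have hd : d ≠ 0 := by
    rintro rfl
    simp_all
  have hirr : Irrational (√21) := by
    rw [irrational_sqrt_ofNat_iff]
    rintro ⟨r, hr⟩
    have : r < 5 := by nlinarith
    interval_cases r <;> omega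
  apply hirr
  refine ⟨|3 * n / d|, ?_⟩
  symm
  rw [Real.sqrt_eq_iff_mul_self_eq (by norm_num) (by positivity)]
  have hdR : (d : ℝ) ≠ 0 := by exact_mod_cast hd
  have hR : 3 * (n : ℝ) ^ 2 = 7 * (d : ℝ) ^ 2 := by exact_mod_cast h
  push_cast
  rw [abs_mul_abs_self]
  field_simp
  linarith

/-- Squared distance in `Λ` as the integral quadratic form `m² + mk + 2k²`. -/
theorem dist_sq_of_lattice_coords {a b : EuclideanSpace ℝ (Fin 2)} {m k m' k' : ℤ}
    (ha : a = ![(m : ℝ) + (k : ℝ) / 2, (k : ℝ) * Real.sqrt 7 / 2])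
    (hb : b = ![(m' : ℝ) + (k' : ℝ) / 2, (k' : ℝ) * Real.sqrt 7 / 2]) :
    dist a b ^ 2 =
      (((m - m') ^ 2 + (m - m') * (k - k') + 2 * (k - k') ^ 2 : ℤ) : ℝ) := by
  have h7 : Real.sqrt 7 ^ 2 = 7 := Real.sq_sqrt (by norm_num)
  rw [EuclideanSpace.dist_eq, Real.sq_sqrt (by positivity)]
  simp only [Fin.sum_univ_two, Real.dist_eq, sq_abs, ha, hb, Matrix.cons_val_zero,
    Matrix.cons_val_one]
  push_cast
  linear_combination ((k : ℝ) - k') ^ 2 / 4 * h7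

/-- No three distinct points of the lattice `Λ` form an equilateral
triangle in `ℝ²`. -/
theorem stmt12 :
    ¬ ∃ a b c : EuclideanSpace ℝ (Fin 2),
      a ∈ LambdaLat ∧ b ∈ LambdaLat ∧ c ∈ LambdaLat ∧ a ≠ b ∧ b ≠ c ∧ a ≠ c ∧
      dist a b = dist b c ∧ dist b c = dist c a := by
  rintro ⟨a, b, c, ⟨m, k, ha⟩, ⟨m', k', hb⟩, ⟨m'', k'', hc⟩, hab, -, -, h₁, h₂⟩
  have e₁ := dist_sq_of_lattice_coords ha hb
  have e₂ := dist_sq_of_lattice_coords hb hc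
  have e₃ := dist_sq_of_lattice_coords hc ha
  have E₁ := e₁.symm.trans ((congrArg (· ^ 2) h₁).trans e₂)
  have E₂ := e₂.symm.trans ((congrArg (· ^ 2) h₂).trans e₃)
  rw [Int.cast_inj] at E₁ E₂
  have hN : (m - m') ^ 2 + (m - m') * (k - k') + 2 * (k - k') ^ 2 = 0 := by
    apply Int.eq_zero_of_three_mul_sq_eq_seven_mul_sq
      (d := (m - m') * (k' - k'') - (k - k') * (m' - m''))
    linear_combination 4 * ((m - m') ^ 2 + (m - m') * (k - k') + 2 * (k - k') ^ 2) * E₁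
      - (2 * (m - m') * (m' - m'') + (m - m') * (k' - k'') + (k - k') * (m' - m'')
        + 4 * (k - k') * (k' - k'')
        - ((m - m') ^ 2 + (m - m') * (k - k') + 2 * (k - k') ^ 2)) * E₂
  rw [hN, Int.cast_zero] at e₁
  exact hab (dist_eq_zero.1 (pow_eq_zero_iff two_ne_zero |>.1 e₁))
end

section
/- Every set of four distinct points of the lattice Λ determines at least 3 distinct positive pairwise Euclidean distances. -/
/-- The squared length of the lattice vector `m (1, 0) + k (1/2, √7/2)` between two points of `Λ`
given by their integer coordinates. -/
def latticeSqDist (p q : ℤ × ℤ) : ℤ :=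
  (p.1 - q.1) ^ 2 + (p.1 - q.1) * (p.2 - q.2) + 2 * (p.2 - q.2) ^ 2

theorem latticeSqDist_comm (p q : ℤ × ℤ) : latticeSqDist p q = latticeSqDist q p := by
  unfold latticeSqDist; ring

theorem latticeSqDist_pos {p q : ℤ × ℤ} (h : p ≠ q) : 0 < latticeSqDist p q := by
  unfold latticeSqDist
  by_contra! hle
  have h2 : p.2 - q.2 = 0 := by
    by_contra hne
    have : 0 < (p.2 - q.2) ^ 2 := by positivity
    nlinarith [sq_nonneg (2 * (p.1 - q.1) + (p.2 - q.2))]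
  have h1 : p.1 - q.1 = 0 := by
    by_contra hne
    have : 0 < (p.1 - q.1) ^ 2 := by positivity
    rw [h2] at hle
    nlinarith
  exact h (Prod.ext (by linarith) (by linarith))

/-- `7` times the square of the determinant of two lattice vectors, by the Lagrange identity. -/
theorem latticeSqDist_lagrange (p q r : ℤ × ℤ) :
    7 * ((q.1 - p.1) * (r.2 - p.2) - (r.1 - p.1) * (q.2 - p.2)) ^ 2 =
      4 * latticeSqDist p q * latticeSqDist p r -
        (latticeSqDist p q + latticeSqDist p r - latticeSqDist q r) ^ 2 := by
  unfold latticeSqDist; ring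

/-- The Gram determinant of three vectors of the plane vanishes. -/
theorem latticeSqDist_gram (p q r u : ℤ × ℤ) (A B C X Y Z : ℤ)
    (hA : A = 2 * latticeSqDist p q) (hB : B = 2 * latticeSqDist p r)
    (hC : C = 2 * latticeSqDist p u)
    (hX : X = latticeSqDist p q + latticeSqDist p r - latticeSqDist q r)
    (hY : Y = latticeSqDist p r + latticeSqDist p u - latticeSqDist r u)
    (hZ : Z = latticeSqDist p q + latticeSqDist p u - latticeSqDist q u) :
    A * (B * C - Y ^ 2) - X * (X * C - Y * Z) + Z * (X * Y - B * Z) = 0 := by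
  subst hA hB hC hX hY hZ
  unfold latticeSqDist
  ring

theorem eq_zero_of_mul_sq_eq_sq {n : ℤ} (hn : ¬ IsSquare n) {x y : ℤ}
    (h : n * x ^ 2 = y ^ 2) : x = 0 := by
  by_contra hx
  obtain ⟨z, rfl⟩ : x ∣ y := (Int.pow_dvd_pow_iff two_ne_zero).1 ⟨n, by linarith⟩
  refine hn ⟨z, mul_right_cancel₀ (pow_ne_zero 2 hx) ?_⟩
  linarith

theorem not_equilateral {p q r : ℤ × ℤ} (hpq : p ≠ q)
    (h₁ : latticeSqDist p q = latticeSqDist p r) (h₂ : latticeSqDist p q = latticeSqDist q r) :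
    False := by
  have hpos := latticeSqDist_pos hpq
  have h := latticeSqDist_lagrange p q r
  rw [← h₁, ← h₂] at h
  generalize latticeSqDist p q = s at *
  have hn : ¬ IsSquare (21 : ℤ) := by norm_num
  have := eq_zero_of_mul_sq_eq_sq hn (x := s)
    (y := 7 * ((q.1 - p.1) * (r.2 - p.2) - (r.1 - p.1) * (q.2 - p.2)))
    (by linear_combination -7 * h)
  omega

theorem not_square {p q r u : ℤ × ℤ} (hpq : p ≠ q) (hpr : p ≠ r)
    (h₁ : latticeSqDist p q = latticeSqDist q r) (h₂ : latticeSqDist p q = latticeSqDist r u)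
    (h₃ : latticeSqDist p q = latticeSqDist p u) (h₄ : latticeSqDist p r = latticeSqDist q u) :
    False := by
  have hs := latticeSqDist_pos hpq
  have ht := latticeSqDist_pos hpr
  have g := latticeSqDist_gram p q r u _ _ _ _ _ _ rfl rfl rfl rfl rfl rfl
  have h := latticeSqDist_lagrange p q u
  rw [← h₁, ← h₂, ← h₃, ← h₄] at g
  rw [← h₃, ← h₄] at h
  generalize latticeSqDist p q = s at *
  generalize latticeSqDist p r = t at *
  have hst : 2 * s - t = 0 := by
    have : t ^ 2 * (2 * s - t) = 0 := by linarith
    simpa [ht.ne'] using this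
  obtain rfl : t = 2 * s := by linarith
  have hn : ¬ IsSquare (7 : ℤ) := by norm_num
  have := eq_zero_of_mul_sq_eq_sq hn (y := 2 * s) (h.trans (by ring))
  rw [this] at h
  nlinarith

theorem not_pentagonal {p q r u : ℤ × ℤ} (hpq : p ≠ q) (hpr : p ≠ r)
    (h₁ : latticeSqDist p q = latticeSqDist q r) (h₂ : latticeSqDist p q = latticeSqDist r u)
    (h₃ : latticeSqDist p r = latticeSqDist q u) (h₄ : latticeSqDist p r = latticeSqDist p u) :
    False := by
  have hs := latticeSqDist_pos hpq
  have ht := latticeSqDist_pos hpr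
  have g := latticeSqDist_gram p q r u _ _ _ _ _ _ rfl rfl rfl rfl rfl rfl
  rw [← h₁, ← h₂, ← h₃, ← h₄] at g
  generalize latticeSqDist p q = s at *
  generalize latticeSqDist p r = t at *
  have hst : s ^ 2 - 3 * s * t + t ^ 2 = 0 := by
    have : (s + t) * (s ^ 2 - 3 * s * t + t ^ 2) = 0 := by linarith
    exact (mul_eq_zero.1 this).resolve_left (by omega)
  have hn : ¬ IsSquare (5 : ℤ) := by norm_num
  have := eq_zero_of_mul_sq_eq_sq hn (x := t) (y := 2 * s - 3 * t)
    (by linear_combination -4 * hst)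
  omega

/-- Four lattice points determine more than two distances. -/
theorem not_two_latticeSqDist {p q r u : ℤ × ℤ} (hpq : p ≠ q) (hpr : p ≠ r) (hpu : p ≠ u)
    (hqr : q ≠ r) (hqu : q ≠ u) (hru : r ≠ u) (s t : ℤ)
    (h₁ : latticeSqDist p q = s ∨ latticeSqDist p q = t)
    (h₂ : latticeSqDist p r = s ∨ latticeSqDist p r = t)
    (h₃ : latticeSqDist p u = s ∨ latticeSqDist p u = t)
    (h₄ : latticeSqDist q r = s ∨ latticeSqDist q r = t)
    (h₅ : latticeSqDist q u = s ∨ latticeSqDist q u = t)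
    (h₆ : latticeSqDist r u = s ∨ latticeSqDist r u = t) : False := by
  have e₁ := @not_equilateral
  have e₂ := @not_square
  have e₃ := @not_pentagonal
  have c₁ := latticeSqDist_comm p q
  have c₂ := latticeSqDist_comm p r
  have c₃ := latticeSqDist_comm p u
  have c₄ := latticeSqDist_comm q r
  have c₅ := latticeSqDist_comm q u
  have c₆ := latticeSqDist_comm r u
  have t₁ := e₁ (r := r) hpq
  have t₂ := e₁ (r := u) hpq
  have t₃ := e₁ (r := u) hpr
  have t₄ := e₁ (r := u) hqr
  have s₁ := e₂ (u := u) hpq hpr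
  have s₂ := e₂ (u := r) hpq hpu
  have s₃ := e₂ (u := u) hpr hpq
  have w₁ := e₃ (u := u) hpq hpr
  have w₂ := e₃ (u := r) hpq hpu
  have w₃ := e₃ (u := u) hpr hpq
  have w₄ := e₃ (u := q) hpr hpu
  have w₅ := e₃ (u := r) hpu hpq
  have w₆ := e₃ (u := q) hpu hpr
  have w₇ := e₃ (u := u) hpq.symm hqr
  have w₈ := e₃ (u := r) hpq.symm hqu
  have w₉ := e₃ (u := u) hpr.symm hqr.symm
  have w₁₀ := e₃ (u := q) hpr.symm hru
  have w₁₁ := e₃ (u := r) hpu.symm hqu.symm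
  have w₁₂ := e₃ (u := q) hpu.symm hru.symm
  clear e₁ e₂ e₃
  grind

theorem exists_int_coords_of_mem_LambdaLat {a : EuclideanSpace ℝ (Fin 2)} (ha : a ∈ LambdaLat) :
    ∃ p : ℤ × ℤ, a 0 = (p.1 : ℝ) + p.2 / 2 ∧ a 1 = (p.2 : ℝ) * √7 / 2 := by
  obtain ⟨m, k, h⟩ := ha
  exact ⟨(m, k), by simp [h], by simp [h]⟩

theorem dist_sq_eq_latticeSqDist {a b : EuclideanSpace ℝ (Fin 2)} {p q : ℤ × ℤ}
    (ha : a 0 = (p.1 : ℝ) + p.2 / 2 ∧ a 1 = (p.2 : ℝ) * √7 / 2)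
    (hb : b 0 = (q.1 : ℝ) + q.2 / 2 ∧ b 1 = (q.2 : ℝ) * √7 / 2) :
    dist a b ^ 2 = latticeSqDist p q := by
  have h7 : √7 ^ 2 = (7 : ℝ) := Real.sq_sqrt (by norm_num)
  rw [EuclideanSpace.dist_eq, Real.sq_sqrt (by positivity), Fin.sum_univ_two, Real.dist_eq,
    Real.dist_eq, sq_abs, sq_abs, ha.1, ha.2, hb.1, hb.2]
  unfold latticeSqDist
  push_cast
  linear_combination ((p.2 : ℝ) - q.2) ^ 2 / 4 * h7

theorem exists_subset_pair_of_ncard_lt_three {α : Type*} [Nonempty α] {S : Set α} (hS : S.Finite)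
    (h : S.ncard < 3) : ∃ x y, S ⊆ {x, y} := by
  rcases (by omega : S.ncard = 0 ∨ S.ncard = 1 ∨ S.ncard = 2) with h | h | h
  · obtain rfl := (Set.ncard_eq_zero hS).1 h
    exact ⟨Classical.arbitrary α, Classical.arbitrary α, Set.empty_subset _⟩
  · obtain ⟨x, rfl⟩ := Set.ncard_eq_one.1 h
    exact ⟨x, x, by simp⟩
  · obtain ⟨x, y, -, rfl⟩ := Set.ncard_eq_two.1 h
    exact ⟨x, y, subset_rfl⟩

/-- Every set of four distinct points of the lattice `Λ` determines at
least `3` distinct (positive) pairwise Euclidean distances. -/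
theorem stmt14 (a b c d : EuclideanSpace ℝ (Fin 2))
    (ha : a ∈ LambdaLat) (hb : b ∈ LambdaLat) (hc : c ∈ LambdaLat) (hd : d ∈ LambdaLat)
    (hab : a ≠ b) (hac : a ≠ c) (had : a ≠ d) (hbc : b ≠ c) (hbd : b ≠ d) (hcd : c ≠ d) :
    3 ≤ ({dist a b, dist a c, dist a d, dist b c, dist b d, dist c d} : Set ℝ).ncard := by
  by_contra! hlt
  obtain ⟨p, hp⟩ := exists_int_coords_of_mem_LambdaLat ha
  obtain ⟨q, hq⟩ := exists_int_coords_of_mem_LambdaLat hb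
  obtain ⟨r, hr⟩ := exists_int_coords_of_mem_LambdaLat hc
  obtain ⟨u, hu⟩ := exists_int_coords_of_mem_LambdaLat hd
  obtain ⟨x, y, hxy⟩ := exists_subset_pair_of_ncard_lt_three (Set.toFinite _) hlt
  simp only [Set.insert_subset_iff, Set.singleton_subset_iff, Set.mem_insert_iff,
    Set.mem_singleton_iff] at hxy
  obtain ⟨h₁, h₂, h₃, h₄, h₅, h₆⟩ := hxy
  have key {v w : EuclideanSpace ℝ (Fin 2)} {i j : ℤ × ℤ}
      (hv : v 0 = (i.1 : ℝ) + i.2 / 2 ∧ v 1 = (i.2 : ℝ) * √7 / 2)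
      (hw : w 0 = (j.1 : ℝ) + j.2 / 2 ∧ w 1 = (j.2 : ℝ) * √7 / 2)
      (h : dist v w = x ∨ dist v w = y) :
      latticeSqDist i j = ⌊x ^ 2⌋ ∨ latticeSqDist i j = ⌊y ^ 2⌋ := by
    rcases h with rfl | rfl <;> simp [dist_sq_eq_latticeSqDist hv hw]
  have hne {v w : EuclideanSpace ℝ (Fin 2)} {i j : ℤ × ℤ}
      (hv : v 0 = (i.1 : ℝ) + i.2 / 2 ∧ v 1 = (i.2 : ℝ) * √7 / 2)
      (hw : w 0 = (j.1 : ℝ) + j.2 / 2 ∧ w 1 = (j.2 : ℝ) * √7 / 2) (h : v ≠ w) : i ≠ j := by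
    rintro rfl
    have h0 := dist_sq_eq_latticeSqDist hv hw
    simp [latticeSqDist, h] at h0
  exact not_two_latticeSqDist (hne hp hq hab) (hne hp hr hac) (hne hp hu had) (hne hq hr hbc)
    (hne hq hu hbd) (hne hr hu hcd) _ _ (key hp hq h₁) (key hp hr h₂) (key hp hu h₃)
    (key hq hr h₄) (key hq hu h₅) (key hr hu h₆)
end

section
/- For every integer n ≥ 2, the quantity g_d(n) is finite for all sufficiently large d and satisfies lim_{d→∞} g_d(n)/d^{n−1} = 1/(n−1)!. Moreover, for all d and n ≥ 2 one has the bounds C(d+1, n−1) + 1 ≤ g_d(n) ≤ C(d+n−1, n−1) + 1. -/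
/-- The set of distinct positive Euclidean distances determined by a finite point set
`P` in `ℝ^d`. -/
def distSet (d : ℕ) (P : Finset (EuclideanSpace ℝ (Fin d))) : Set ℝ :=
  {r : ℝ | 0 < r ∧ ∃ x ∈ P, ∃ y ∈ P, dist x y = r}

/-- `g_d(n)`: the minimal positive integer `N` such that every set of `N` distinct points
in `ℝ^d` determines at least `n` distinct positive distances. -/
noncomputable def gMin (d n : ℕ) : ℕ :=
  sInf {N : ℕ | 0 < N ∧
    ∀ P : Finset (EuclideanSpace ℝ (Fin d)), P.card = N → n ≤ (distSet d P).ncard}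

/-- A function orthogonal to all polynomials of degree at most `s` kills the mixed moments. -/
theorem sum_sum_normSq_pow_mul_inner_pow_eq_zero {d s : ℕ}
    {A : Finset (EuclideanSpace ℝ (Fin d))} {f : EuclideanSpace ℝ (Fin d) → ℝ}
    (hf : ∀ q : MvPolynomial (Fin d) ℝ, q.totalDegree ≤ s →
      ∑ a ∈ A, f a * MvPolynomial.eval a q = 0)
    {i j : ℕ} (k : ℕ) (hij : 2 * i + j ≤ s) :
    ∑ b ∈ A, ∑ a ∈ A, f a * f b *
      ((‖a‖ ^ 2) ^ i * (inner ℝ a b) ^ j * (‖b‖ ^ 2) ^ k) = 0 := by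
  refine Finset.sum_eq_zero fun b _ => ?_
  have hdeg : ((∑ l, MvPolynomial.X l ^ 2) ^ i *
      (∑ l, MvPolynomial.C (b l) * MvPolynomial.X l) ^ j :
        MvPolynomial (Fin d) ℝ).totalDegree ≤ s := by
    refine (MvPolynomial.totalDegree_mul _ _).trans (le_trans (add_le_add
      ((MvPolynomial.totalDegree_pow _ _).trans (Nat.mul_le_mul_left i (m := 2) ?_))
      ((MvPolynomial.totalDegree_pow _ _).trans (Nat.mul_le_mul_left j (m := 1) ?_)))
      (by omega))
    · refine MvPolynomial.totalDegree_finsetSum_le fun l _ => ?_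
      simp
    · refine MvPolynomial.totalDegree_finsetSum_le fun l _ => ?_
      refine (MvPolynomial.totalDegree_mul _ _).trans ?_
      simp
  have h := hf _ hdeg
  calc _ = (∑ a ∈ A, f a * MvPolynomial.eval a ((∑ l, MvPolynomial.X l ^ 2) ^ i *
      (∑ l, MvPolynomial.C (b l) * MvPolynomial.X l) ^ j)) * (f b * (‖b‖ ^ 2) ^ k) := by
        rw [Finset.sum_mul]
        refine Finset.sum_congr rfl fun a _ => ?_
        simp only [map_mul, map_pow, map_sum, MvPolynomial.eval_X, MvPolynomial.eval_C,
          EuclideanSpace.real_norm_sq_eq, PiLp.inner_apply, RCLike.inner_apply, conj_trivial]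
        ring
    _ = 0 := by rw [h, zero_mul]

theorem sum_sum_prod_sub_dist_sq_eq_zero {d s : ℕ}
    {A : Finset (EuclideanSpace ℝ (Fin d))} {f : EuclideanSpace ℝ (Fin d) → ℝ}
    (hf : ∀ q : MvPolynomial (Fin d) ℝ, q.totalDegree ≤ s →
      ∑ a ∈ A, f a * MvPolynomial.eval a q = 0)
    (T : Finset ℝ) {i j k : ℕ} (hT : i + j + k + T.card ≤ s) :
    ∑ b ∈ A, ∑ a ∈ A, f a * f b *
      ((‖a‖ ^ 2) ^ i * (inner ℝ a b) ^ j * (‖b‖ ^ 2) ^ k *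
        ∏ t ∈ T, (t ^ 2 - dist a b ^ 2)) = 0 := by
  induction T using Finset.induction_on generalizing i j k with
  | empty =>
    simp only [Finset.prod_empty, mul_one]
    simp only [Finset.card_empty, add_zero] at hT
    rcases le_or_gt (2 * i + j) s with h | h
    · exact sum_sum_normSq_pow_mul_inner_pow_eq_zero hf k h
    · rw [Finset.sum_comm,
        ← sum_sum_normSq_pow_mul_inner_pow_eq_zero hf (i := k) (j := j) i (by omega)]
      refine Finset.sum_congr rfl fun a _ => Finset.sum_congr rfl fun b _ => ?_
      rw [real_inner_comm]
      ring
  | insert t T ht ih =>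
    rw [Finset.card_insert_of_notMem ht] at hT
    have h0 := ih (i := i) (j := j) (k := k) (by omega)
    have h1 := ih (i := i + 1) (j := j) (k := k) (by omega)
    have h2 := ih (i := i) (j := j + 1) (k := k) (by omega)
    have h3 := ih (i := i) (j := j) (k := k + 1) (by omega)
    have h : t ^ 2 * 0 - 0 + 2 * 0 - 0 = (0 : ℝ) := by norm_num
    rw [← h]
    nth_rewrite 1 [← h0]
    nth_rewrite 1 [← h1]
    nth_rewrite 1 [← h2]
    nth_rewrite 1 [← h3]
    simp only [Finset.mul_sum, ← Finset.sum_sub_distrib, ← Finset.sum_add_distrib]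
    refine Finset.sum_congr rfl fun b _ => Finset.sum_congr rfl fun a _ => ?_
    rw [Finset.prod_insert ht, dist_eq_norm a b, norm_sub_sq_real]
    ring

theorem exists_ne_zero_orthogonal_totalDegree_le {d s : ℕ}
    {A : Finset (EuclideanSpace ℝ (Fin d))} (hA : (d + s).choose s < A.card) :
    ∃ f : EuclideanSpace ℝ (Fin d) → ℝ, (∃ a ∈ A, f a ≠ 0) ∧
      ∀ q : MvPolynomial (Fin d) ℝ, q.totalDegree ≤ s →
        ∑ a ∈ A, f a * MvPolynomial.eval a q = 0 := by
  classical
  let M : Matrix (Sym (Option (Fin d)) s) A ℝ := fun m a =>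
    ((m : Multiset (Option (Fin d))).map fun o => o.elim 1 fun l => a.1 l).prod
  have hker : LinearMap.ker (Matrix.mulVecLin M) ≠ ⊥ := by
    apply LinearMap.ker_ne_bot_of_finrank_lt
    simpa [Sym.card_sym_eq_choose, show d + 1 + s - 1 = d + s by omega] using hA
  obtain ⟨g, hg, hg0⟩ := (Submodule.ne_bot_iff _).1 hker
  obtain ⟨a₀, ha₀⟩ := Function.ne_iff.1 hg0
  refine ⟨fun a => if h : a ∈ A then g ⟨a, h⟩ else 0, ⟨a₀, a₀.2, by simpa using ha₀⟩,
    fun q hq => ?_⟩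
  simp only [MvPolynomial.eval_eq, Finset.mul_sum]
  rw [Finset.sum_comm]
  refine Finset.sum_eq_zero fun m hm => ?_
  have hms : (Finsupp.toMultiset m).card ≤ s := by
    rw [Finsupp.card_toMultiset]
    exact (MvPolynomial.le_totalDegree hm).trans hq
  have hm' := congrFun hg ⟨(Finsupp.toMultiset m).map some +
    Multiset.replicate (s - (Finsupp.toMultiset m).card) none, by
      rw [Multiset.card_add, Multiset.card_map, Multiset.card_replicate]; omega⟩
  rw [← Finset.sum_coe_sort A]
  simp only [Matrix.mulVecLin_apply, Matrix.mulVec, dotProduct] at hm'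
  refine Eq.trans ?_ ((congrArg (q.coeff m * ·) hm').trans (mul_zero _))
  rw [Finset.mul_sum]
  refine Finset.sum_congr rfl fun a _ => ?_
  have hM : ∏ l ∈ m.support, a.1 l ^ m l = ((Finsupp.toMultiset m).map fun l => a.1 l).prod := by
    rw [Finsupp.toMultiset_map, Finsupp.prod_toMultiset, Finsupp.prod_mapDomain_index]
    · rfl
    · simp
    · exact fun _ _ _ => pow_add _ _ _
  simp [M, hM, Function.comp_def]
  ring

/-- A set in `ℝ^d` all of whose positive distances lie in a set of `s` positive reals has at
most `(d + s).choose s` points. -/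
theorem card_le_choose_of_dist_mem {d s : ℕ} {A : Finset (EuclideanSpace ℝ (Fin d))}
    {T : Finset ℝ} (hT : T.card ≤ s) (hpos : ∀ t ∈ T, 0 < t)
    (hA : ∀ a ∈ A, ∀ b ∈ A, a ≠ b → dist a b ∈ T) : A.card ≤ (d + s).choose s := by
  by_contra! hlt
  obtain ⟨f, ⟨a₀, ha₀, hf₀⟩, hf⟩ := exists_ne_zero_orthogonal_totalDegree_le hlt
  have h := sum_sum_prod_sub_dist_sq_eq_zero hf T (i := 0) (j := 0) (k := 0) (by omega)
  have hdiag : ∀ b ∈ A, ∑ a ∈ A, f a * f b * ((‖a‖ ^ 2) ^ 0 * (inner ℝ a b) ^ 0 *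
      (‖b‖ ^ 2) ^ 0 * ∏ t ∈ T, (t ^ 2 - dist a b ^ 2)) = f b ^ 2 * ∏ t ∈ T, t ^ 2 := by
    intro b hb
    rw [Finset.sum_eq_single_of_mem b hb]
    · simp [pow_two]
    · intro a ha hab
      rw [Finset.prod_eq_zero (f := fun t => t ^ 2 - dist a b ^ 2) (hA a ha b hb hab) (sub_self _)]
      ring
  rw [Finset.sum_congr rfl hdiag, ← Finset.sum_mul] at h
  refine (mul_pos ?_ (Finset.prod_pos fun t ht => pow_pos (hpos t ht) 2)).ne' h
  exact Finset.sum_pos' (fun b _ => sq_nonneg (f b)) ⟨a₀, ha₀, by positivity⟩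

/-- The `k`-subsets of a `(d + 1)`-set map to `ℝ^d` so that the distance of two images depends only
on the size of the intersection. -/
theorem exists_dist_eq_sqrt (d k : ℕ) :
    ∃ φ : Finset (Fin (d + 1)) → EuclideanSpace ℝ (Fin d),
      ∀ S T : Finset (Fin (d + 1)), S.card = k → T.card = k →
        dist (φ S) (φ T) = √(2 * ((k : ℝ) - (S ∩ T).card)) := by
  classical
  let E := EuclideanSpace ℝ (Fin (d + 1))
  let e : E := WithLp.toLp 2 fun _ => 1
  have he : e ≠ 0 := fun h => one_ne_zero (α := ℝ) (congrArg (fun v : E => v 0) h)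
  have : Fact (Module.finrank ℝ E = d + 1) := ⟨by simp [E]⟩
  let B := OrthonormalBasis.fromOrthogonalSpanSingleton (𝕜 := ℝ) d he
  let v : Finset (Fin (d + 1)) → E := fun S => WithLp.toLp 2 fun l => if l ∈ S then 1 else 0
  refine ⟨fun S => B.repr ((ℝ ∙ e)ᗮ.orthogonalProjectionOnto (v S)), fun S T hS hT => ?_⟩
  have hmem : v S - v T ∈ (ℝ ∙ e)ᗮ := by
    rw [Submodule.mem_orthogonal_singleton_iff_inner_right]
    rw [inner_sub_right, sub_eq_zero, PiLp.inner_apply, PiLp.inner_apply]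
    simp [v, e, hS, hT]
  rw [LinearIsometryEquiv.dist_map, dist_eq_norm, ← map_sub,
    Submodule.coe_norm, ← Submodule.starProjection_apply,
    Submodule.starProjection_eq_self_iff.2 hmem,
    EuclideanSpace.norm_eq]
  congr 1
  have : ∀ l, ‖(v S - v T) l‖ ^ 2 = (if l ∈ S then (1 : ℝ) else 0) + (if l ∈ T then 1 else 0)
      - 2 * (if l ∈ S ∩ T then 1 else 0) := by
    intro l
    rw [show (v S - v T) l = (if l ∈ S then (1 : ℝ) else 0) - if l ∈ T then 1 else 0 from rfl,
      Real.norm_eq_abs, sq_abs]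
    by_cases h1 : l ∈ S <;> by_cases h2 : l ∈ T <;> norm_num [h1, h2]
  simp only [this, Finset.sum_sub_distrib, Finset.sum_add_distrib, ← Finset.mul_sum,
    Finset.sum_boole, Finset.filter_univ_mem, hS, hT]
  ring

theorem finite_distSet (d : ℕ) (P : Finset (EuclideanSpace ℝ (Fin d))) : (distSet d P).Finite := by
  refine ((P ×ˢ P).image fun x => dist x.1 x.2).finite_toSet.subset ?_
  rintro r ⟨-, x, hx, y, hy, rfl⟩
  exact Finset.mem_coe.2 (Finset.mem_image.2 ⟨(x, y), Finset.mk_mem_product hx hy, rfl⟩)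

theorem lt_ncard_distSet {d s : ℕ} {P : Finset (EuclideanSpace ℝ (Fin d))}
    (hP : (d + s).choose s < P.card) : s < (distSet d P).ncard := by
  by_contra! h
  refine hP.not_ge (card_le_choose_of_dist_mem (T := (finite_distSet d P).toFinset) ?_ ?_ ?_)
  · rwa [← Set.ncard_eq_toFinset_card _ (finite_distSet d P)]
  · intro t ht
    exact ((finite_distSet d P).mem_toFinset.1 ht).1
  · intro a ha b hb hab
    exact (finite_distSet d P).mem_toFinset.2 ⟨dist_pos.2 hab, a, ha, b, hb, rfl⟩

theorem exists_card_eq_ncard_distSet_le {d k N : ℕ} (hN : N ≤ (d + 1).choose k) :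
    ∃ P : Finset (EuclideanSpace ℝ (Fin d)), P.card = N ∧ (distSet d P).ncard ≤ k := by
  classical
  obtain ⟨φ, hφ⟩ := exists_dist_eq_sqrt d k
  have hcard : N ≤ (Finset.powersetCard k (Finset.univ : Finset (Fin (d + 1)))).card := by
    simpa using hN
  obtain ⟨F, hF, rfl⟩ := Finset.exists_subset_card_eq hcard
  have hFk : ∀ S ∈ F, S.card = k := fun S hS => (Finset.mem_powersetCard.1 (hF hS)).2
  refine ⟨F.image φ, Finset.card_image_of_injOn fun S hS T hT hST => ?_, ?_⟩
  · have h := hφ S T (hFk S hS) (hFk T hT)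
    rw [hST, dist_self, eq_comm, Real.sqrt_eq_zero'] at h
    have h' : k ≤ (S ∩ T).card := by
      have : (k : ℝ) ≤ (S ∩ T).card := by linarith
      exact_mod_cast this
    have h₁ := Finset.eq_of_subset_of_card_le Finset.inter_subset_left ((hFk S hS).trans_le h')
    have h₂ := Finset.eq_of_subset_of_card_le Finset.inter_subset_right ((hFk T hT).trans_le h')
    exact h₁.symm.trans h₂
  · refine (Set.ncard_le_ncard (t := ((Finset.range k).image fun j : ℕ => √(2 * ((k : ℝ) - j)) :
      Finset ℝ)) ?_ (Finset.finite_toSet _)).trans ?_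
    · rintro r ⟨hr, x, hx, y, hy, rfl⟩
      obtain ⟨S, hS, rfl⟩ := Finset.mem_image.1 hx
      obtain ⟨T, hT, rfl⟩ := Finset.mem_image.1 hy
      rw [hφ S T (hFk S hS) (hFk T hT)] at hr ⊢
      rw [Real.sqrt_pos] at hr
      have : ((S ∩ T).card : ℝ) < k := by linarith
      simp only [Finset.coe_image, Finset.coe_range]
      exact ⟨_, by exact_mod_cast this, rfl⟩
    · rw [Set.ncard_coe_finset]
      exact Finset.card_image_le.trans_eq (Finset.card_range k)

theorem choose_add_one_mem (d k : ℕ) :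
    (d + k).choose k + 1 ∈ {N : ℕ | 0 < N ∧
      ∀ P : Finset (EuclideanSpace ℝ (Fin d)), P.card = N → k + 1 ≤ (distSet d P).ncard} :=
  ⟨Nat.succ_pos _, fun _ hP => lt_ncard_distSet (by omega)⟩

theorem gMin_succ_le (d k : ℕ) : gMin d (k + 1) ≤ (d + k).choose k + 1 :=
  Nat.sInf_le (choose_add_one_mem d k)

theorem choose_lt_gMin_succ (d k : ℕ) : (d + 1).choose k < gMin d (k + 1) := by
  by_contra! h
  obtain ⟨P, hP, hle⟩ := exists_card_eq_ncard_distSet_le h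
  exact absurd ((Nat.sInf_mem ⟨_, choose_add_one_mem d k⟩).2 P hP) (by omega)

theorem tendsto_choose_add_div_pow (c k : ℕ) :
    Filter.Tendsto (fun d : ℕ => ((d + c).choose k : ℝ) / (d : ℝ) ^ k) Filter.atTop
      (nhds (1 / (k.factorial : ℝ))) := by
  have hfac : (k.factorial : ℝ) ≠ 0 := by positivity
  have h₁ : Filter.Tendsto (fun m : ℕ => (m.choose k : ℝ) / ((m : ℝ) ^ k / k.factorial))
      Filter.atTop (nhds 1) := by
    refine (Asymptotics.isEquivalent_iff_tendsto_one ?_).1 (isEquivalent_choose k)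
    filter_upwards [Filter.eventually_gt_atTop 0] with m hm
    positivity
  have h₂ := h₁.comp (Filter.tendsto_add_atTop_nat c)
  have h₃ : Filter.Tendsto (fun d : ℕ => ((d + c : ℕ) : ℝ) / d) Filter.atTop (nhds 1) := by
    have := (tendsto_const_div_atTop_nhds_zero_nat (c : ℝ)).const_add 1
    rw [add_zero] at this
    refine this.congr' ?_
    filter_upwards [Filter.eventually_gt_atTop 0] with d hd
    push_cast
    field_simp
  have h₄ := (h₂.mul (h₃.pow k)).mul_const (1 / (k.factorial : ℝ))
  rw [one_pow, one_mul, one_mul] at h₄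
  refine h₄.congr' ?_
  filter_upwards [Filter.eventually_gt_atTop 0] with d hd
  have hdc : ((d + c : ℕ) : ℝ) ≠ 0 := by positivity
  simp only [Function.comp_apply, div_pow]
  field_simp

theorem tendsto_gMin_succ_div_pow {k : ℕ} (hk : k ≠ 0) :
    Filter.Tendsto (fun d : ℕ => (gMin d (k + 1) : ℝ) / (d : ℝ) ^ k) Filter.atTop
      (nhds (1 / (k.factorial : ℝ))) := by
  have hpow : Filter.Tendsto (fun d : ℕ => 1 / (d : ℝ) ^ k) Filter.atTop (nhds 0) :=
    tendsto_const_nhds.div_atTop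
      ((Filter.tendsto_pow_atTop hk).comp tendsto_natCast_atTop_atTop)
  have hupper := (tendsto_choose_add_div_pow k k).add hpow
  rw [add_zero] at hupper
  refine tendsto_of_tendsto_of_tendsto_of_le_of_le (tendsto_choose_add_div_pow 1 k) hupper
    (fun d => ?_) (fun d => ?_)
  · exact div_le_div_of_nonneg_right (Nat.cast_le.2 (choose_lt_gMin_succ d k).le)
      (by positivity)
  · dsimp only
    rw [← add_div]
    exact div_le_div_of_nonneg_right (by exact_mod_cast gMin_succ_le d k) (by positivity)

/-- For every integer `n ≥ 2`: `g_d(n)` is finite (well defined) for all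
sufficiently large `d`; `lim_{d→∞} g_d(n) / d^{n-1} = 1 / (n-1)!`; and for all `d ≥ 1` one
has `C(d+1, n-1) + 1 ≤ g_d(n) ≤ C(d+n-1, n-1) + 1`. -/
theorem stmt16 (n : ℕ) (hn : 2 ≤ n) :
    (∃ D : ℕ, ∀ d : ℕ, D ≤ d →
      {N : ℕ | 0 < N ∧
        ∀ P : Finset (EuclideanSpace ℝ (Fin d)), P.card = N →
          n ≤ (distSet d P).ncard}.Nonempty) ∧
    Filter.Tendsto (fun d : ℕ => (gMin d n : ℝ) / (d : ℝ) ^ (n - 1)) Filter.atTop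
      (nhds (1 / (Nat.factorial (n - 1) : ℝ))) ∧
    ∀ d : ℕ, 1 ≤ d →
      (d + 1).choose (n - 1) + 1 ≤ gMin d n ∧ gMin d n ≤ (d + n - 1).choose (n - 1) + 1 := by
  obtain ⟨k, rfl⟩ : ∃ k, n = k + 1 := ⟨n - 1, by omega⟩
  refine ⟨⟨0, fun d _ => ⟨_, choose_add_one_mem d k⟩⟩, ?_, fun d _ => ⟨?_, ?_⟩⟩
  · exact tendsto_gMin_succ_div_pow (by omega)
  · exact choose_lt_gMin_succ d k
  · exact gMin_succ_le d k
end

section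
/- Assume the Continuum Hypothesis. Then there exists a simple graph Γ with chromatic number exactly ℵ₁ such that for every positive integer n, every subgraph of Γ on n vertices contains an independent set of cardinality at least n/4. -/
open Cardinal

/-- The shift graph on ordered pairs of distinct elements of `α`: the pairs `(a, b)` and `(b, c)`
are adjacent. -/
def shiftGraph (α : Type*) : SimpleGraph {p : α × α // p.1 ≠ p.2} where
  Adj v w := v.1.2 = w.1.1 ∨ w.1.2 = v.1.1
  symm := ⟨fun _ _ h => h.symm⟩
  loopless := ⟨fun v h => v.2 (h.elim Eq.symm Eq.symm)⟩

/-- The shift graph on `Set β` can be colored by an element at which the two sets of a pair differ,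
together with the side it lies on. -/
theorem shiftGraph_set_coloring (β : Type*) :
    Nonempty ((shiftGraph (Set β)).Coloring (β × Prop)) := by
  have hdiff : ∀ v : {p : Set β × Set β // p.1 ≠ p.2}, ∃ r, ¬(r ∈ v.1.1 ↔ r ∈ v.1.2) := by
    intro v
    by_contra! h
    exact v.2 (Set.ext h)
  choose r hr using hdiff
  refine ⟨SimpleGraph.Coloring.mk (fun v => (r v, r v ∈ v.1.1)) ?_⟩
  intro v w hvw heq
  obtain ⟨h₁, h₂⟩ := Prod.mk.inj heq
  have hv := hr v
  have hw := hr w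
  rw [← h₁] at h₂ hw
  rcases hvw with h | h
  · rw [h, ← h₂] at hv
    exact hv Iff.rfl
  · rw [h, ← h₂] at hw
    exact hw Iff.rfl

/-- A coloring of the shift graph on `α` by `C` yields an injection of `α` into `Set C`. -/
theorem mk_le_two_power_of_shiftGraph_coloring {α C : Type}
    (c : (shiftGraph α).Coloring C) : #α ≤ 2 ^ #C := by
  rw [← mk_set]
  refine mk_le_of_injective (f := fun a => {x : C | ∃ v, v.1.1 = a ∧ c v = x}) ?_
  intro a b hab
  by_contra hne
  have hmem : c ⟨(a, b), hne⟩ ∈ {x : C | ∃ v, v.1.1 = a ∧ c v = x} := ⟨_, rfl, rfl⟩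
  obtain ⟨w, hw, hcw⟩ := (Set.ext_iff.1 hab _).1 hmem
  exact c.valid (v := ⟨(a, b), hne⟩) (w := w) (Or.inl hw.symm) hcw.symm

theorem two_pow_card_le_four_mul_card_separating {α : Type*} [DecidableEq α] {T : Finset α}
    {a b : α} (ha : a ∈ T) (hb : b ∈ T) (hab : a ≠ b) :
    2 ^ T.card ≤ 4 * (T.powerset.filter fun S => a ∈ S ∧ b ∉ S).card := by
  have hb' : b ∈ T.erase a := Finset.mem_erase.2 ⟨hab.symm, hb⟩
  have hcard : T.card = ((T.erase a).erase b).card + 2 := by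
    have h₁ := Finset.card_erase_add_one ha
    have h₂ := Finset.card_erase_add_one hb'
    omega
  have hle : ((T.erase a).erase b).powerset.card ≤
      (T.powerset.filter fun S => a ∈ S ∧ b ∉ S).card := by
    refine Finset.card_le_card_of_injOn (insert a) ?_ ?_
    · intro S hS
      have hS' := Finset.mem_powerset.1 hS
      simp only [Finset.coe_filter, Set.mem_ofPred_eq, Finset.mem_powerset]
      refine ⟨Finset.insert_subset ha fun x hx => ?_, Finset.mem_insert_self _ _, fun h => ?_⟩
      · exact Finset.mem_of_mem_erase (Finset.mem_of_mem_erase (hS' hx))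
      · rcases Finset.mem_insert.1 h with h | h
        · exact hab h.symm
        · exact Finset.notMem_erase _ _ (hS' h)
    · intro S hS S' hS' h
      have key : ∀ U ∈ ((T.erase a).erase b).powerset, a ∉ U := fun U hU haU =>
        Finset.notMem_erase _ _ (Finset.mem_of_mem_erase (Finset.mem_powerset.1 hU haU))
      rw [← Finset.erase_insert (key S hS), ← Finset.erase_insert (key S' hS')]
      exact congrArg (fun U => U.erase a) h
  rw [Finset.card_powerset] at hle
  rw [hcard, pow_add]
  omega

/-- Every finite set of vertices of a shift graph contains an independent set with at least a
quarter of its elements. -/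
theorem exists_independent_quarter_shiftGraph {α : Type*}
    (H : Finset {p : α × α // p.1 ≠ p.2}) :
    ∃ I ⊆ H, H.card ≤ 4 * I.card ∧ ∀ x ∈ I, ∀ y ∈ I, ¬(shiftGraph α).Adj x y := by
  classical
  set T : Finset α := H.image (fun v => v.1.1) ∪ H.image (fun v => v.1.2)
  have hsum : ∑ _S ∈ T.powerset, H.card ≤
      ∑ S ∈ T.powerset, 4 * (H.filter fun v => v.1.1 ∈ S ∧ v.1.2 ∉ S).card := by
    rw [← Finset.mul_sum]
    simp only [Finset.card_filter]
    rw [Finset.sum_comm]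
    simp only [← Finset.card_filter]
    rw [Finset.mul_sum, Finset.sum_const, Finset.card_powerset, smul_eq_mul, mul_comm,
      ← smul_eq_mul]
    refine Finset.card_nsmul_le_sum _ _ _ fun v hv => ?_
    exact two_pow_card_le_four_mul_card_separating
      (Finset.mem_union_left _ (Finset.mem_image_of_mem _ hv))
      (Finset.mem_union_right _ (Finset.mem_image_of_mem (fun v => v.1.2) hv)) v.2
  obtain ⟨S, -, hS⟩ := Finset.exists_le_of_sum_le (Finset.powerset_nonempty T) hsum
  refine ⟨_, Finset.filter_subset _ _, hS, ?_⟩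
  intro x hx y hy hxy
  have hx' := (Finset.mem_filter.1 hx).2
  have hy' := (Finset.mem_filter.1 hy).2
  rcases hxy with h | h
  · exact hx'.2 (h ▸ hy'.1)
  · exact hy'.2 (h ▸ hx'.1)

/-- Assume the Continuum Hypothesis (`2^{ℵ₀} = ℵ₁`).  Then there is a
simple graph `Γ` whose chromatic number is exactly `ℵ₁` (it admits a proper coloring with
`ℵ₁` colors, and every proper coloring uses at least `ℵ₁` colors) such that for every
positive integer `n`, every subgraph of `Γ` on `n` vertices contains an independent set of
cardinality at least `n / 4`. -/
theorem stmt17 (hCH : Cardinal.continuum = Cardinal.aleph 1) :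
    ∃ (V : Type) (Γ : SimpleGraph V),
      (∃ C : Type, Cardinal.mk C = Cardinal.aleph 1 ∧ Nonempty (Γ.Coloring C)) ∧
      (∀ C : Type, Nonempty (Γ.Coloring C) → Cardinal.aleph 1 ≤ Cardinal.mk C) ∧
      ∀ H : Finset V, ∃ I : Finset V, I ⊆ H ∧
        (H.card : ℝ) / 4 ≤ (I.card : ℝ) ∧
        ∀ x ∈ I, ∀ y ∈ I, ¬ Γ.Adj x y := by
  have hCH₀ : (𝔠 : Cardinal.{0}) = ℵ₁ := by
    apply lift_injective
    rw [lift_continuum, lift_aleph, Ordinal.lift_one]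
    exact hCH
  refine ⟨_, shiftGraph (Set ℝ), ⟨ℝ × Prop, ?_, shiftGraph_set_coloring ℝ⟩, ?_, fun H => ?_⟩
  · rw [mk_prod, lift_id, lift_id, mk_real, hCH₀, mk_Prop]
    exact mul_eq_left (aleph0_le_aleph 1) (ofNat_le_aleph0.trans (aleph0_le_aleph 1)) two_ne_zero
  · rintro C ⟨c⟩
    have hle := mk_le_two_power_of_shiftGraph_coloring c
    rw [mk_set, mk_real] at hle
    rw [← succ_aleph0, Order.succ_le_iff]
    by_contra! hC
    have h := (cantor 𝔠).trans_le (hle.trans (power_le_power_left two_ne_zero hC))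
    rw [two_power_aleph0] at h
    exact h.false
  · obtain ⟨I, hIH, hcard, hind⟩ := exists_independent_quarter_shiftGraph H
    refine ⟨I, hIH, ?_, hind⟩
    have : (H.card : ℝ) ≤ 4 * I.card := by exact_mod_cast hcard
    linarith
end

section
/- Let D be any linearly ordered set and let H be any set of n vertices of the shift graph Γ(D), for a positive integer n. Then H contains an independent subset (no two of its elements adjacent in Γ(D)) of cardinality at least n/4. -/
/-- Among the subsets of `V`, at least a quarter contain `x` but not `y`. -/
theorem two_pow_card_le_four_mul_card_filter_separating {α : Type*} [DecidableEq α]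
    {V : Finset α} {x y : α} (hx : x ∈ V) (hy : y ∈ V) (hxy : x ≠ y) :
    2 ^ V.card ≤ 4 * (V.powerset.filter fun A => x ∈ A ∧ y ∉ A).card := by
  have hcard : V.card = ((V.erase x).erase y).card + 2 := by
    have h₁ := Finset.card_erase_add_one hx
    have h₂ := Finset.card_erase_add_one (Finset.mem_erase.2 ⟨hxy.symm, hy⟩)
    omega
  have hle : ((V.erase x).erase y).powerset.card ≤
      (V.powerset.filter fun A => x ∈ A ∧ y ∉ A).card := by
    refine Finset.card_le_card_of_injOn (insert x) ?_ ?_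
    · intro A hA
      have hA' : A ⊆ (V.erase x).erase y :=
        Finset.mem_powerset.1 (Finset.mem_coe.1 hA)
      simp only [Finset.coe_filter, Finset.mem_powerset, Set.mem_ofPred_eq]
      refine ⟨Finset.insert_subset hx fun a ha => ?_, Finset.mem_insert_self x A, fun h => ?_⟩
      · exact Finset.mem_of_mem_erase (Finset.mem_of_mem_erase (hA' ha))
      · rcases Finset.mem_insert.1 h with h | h
        · exact hxy h.symm
        · simpa using hA' h
    · intro A hA B hB hAB
      have hA' : A ⊆ (V.erase x).erase y :=
        Finset.mem_powerset.1 (Finset.mem_coe.1 hA)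
      have hB' : B ⊆ (V.erase x).erase y :=
        Finset.mem_powerset.1 (Finset.mem_coe.1 hB)
      have hxA : x ∉ A := fun h => by simpa using hA' h
      have hxB : x ∉ B := fun h => by simpa using hB' h
      rw [← Finset.erase_insert hxA, ← Finset.erase_insert hxB]
      exact congrArg (Finset.erase · x) hAB
  rw [Finset.card_powerset] at hle
  rw [hcard, pow_add]
  omega

/-- Every finite family of ordered pairs of distinct points admits a set of points that contains
the first but not the second coordinate of at least a quarter of the pairs. -/
theorem exists_card_le_four_mul_card_filter_separating {ι α : Type*} [DecidableEq α]
    (H : Finset ι) (f g : ι → α) (hfg : ∀ i ∈ H, f i ≠ g i) :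
    ∃ A : Finset α, H.card ≤ 4 * (H.filter fun i => f i ∈ A ∧ g i ∉ A).card := by
  set V := H.image f ∪ H.image g with hV
  have hsum : ∑ _A ∈ V.powerset, H.card ≤
      ∑ A ∈ V.powerset, 4 * (H.filter fun i => f i ∈ A ∧ g i ∉ A).card := by
    calc ∑ _A ∈ V.powerset, H.card = ∑ _i ∈ H, 2 ^ V.card := by
          simp [mul_comm]
      _ ≤ ∑ i ∈ H, 4 * (V.powerset.filter fun A => f i ∈ A ∧ g i ∉ A).card :=
          Finset.sum_le_sum fun i hi => two_pow_card_le_four_mul_card_filter_separating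
            (Finset.mem_union_left _ (Finset.mem_image_of_mem f hi))
            (Finset.mem_union_right _ (Finset.mem_image_of_mem g hi)) (hfg i hi)
      _ = ∑ A ∈ V.powerset, 4 * (H.filter fun i => f i ∈ A ∧ g i ∉ A).card := by
          simp only [← Finset.mul_sum, Finset.card_filter]
          rw [Finset.sum_comm]
  obtain ⟨A, -, hA⟩ := Finset.exists_le_of_sum_le (Finset.powerset_nonempty V) hsum
  exact ⟨A, hA⟩

/-- Let `D` be a linearly ordered set and let `Γ(D)` be its shift graph:
vertices are pairs `(x, y)` with `x < y`, with `(x, y)` adjacent to `(y, z)` for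
`x < y < z`.  Every set `H` of `n` vertices of `Γ(D)` contains an independent subset of
cardinality at least `n / 4`.  (A set `I` of vertices is independent iff `a.2 ≠ b.1` for
all `a, b ∈ I`; note that `a.2 ≠ a.1` holds automatically.) -/
theorem stmt18 (D : Type*) [LinearOrder D] (n : ℕ) (hn : 0 < n)
    (H : Finset {p : D × D // p.1 < p.2}) (hH : H.card = n) :
    ∃ I : Finset {p : D × D // p.1 < p.2}, I ⊆ H ∧
      (n : ℝ) / 4 ≤ (I.card : ℝ) ∧
      ∀ a ∈ I, ∀ b ∈ I, a.val.2 ≠ b.val.1 := by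
  obtain ⟨A, hA⟩ := exists_card_le_four_mul_card_filter_separating H
    (fun p => p.val.1) (fun p => p.val.2) fun p _ => p.prop.ne
  refine ⟨H.filter fun p => p.val.1 ∈ A ∧ p.val.2 ∉ A, Finset.filter_subset _ H, ?_,
    fun a ha b hb hab => ?_⟩
  · rw [← hH, div_le_iff₀ (by norm_num), mul_comm]
    exact_mod_cast hA
  · exact (Finset.mem_filter.1 ha).2.2 (hab ▸ (Finset.mem_filter.1 hb).2.1)
end

section
/- Let X be an infinite well-ordered set and let D be a linearly ordered set admitting a bijection φ : D → {0,1}^X. Then the shift graph Γ(D) admits a proper coloring using at most |X × {0,1}| colors (namely, color the vertex (d₁, d₂) with the pair (δ, φ(d₁)(δ)) where δ is the least element of X at which φ(d₁) and φ(d₂) differ); in particular, the chromatic number of Γ(D) is at most |X|. -/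
/-- Let `X` be an infinite well-ordered set, `D` a linearly ordered set,
and `φ : D → {0,1}^X` a bijection.  For `d₁ ≠ d₂`, let `δmin d₁ d₂` be the least element of
`X` at which `φ d₁` and `φ d₂` differ (it exists by well-foundedness; here it is supplied
together with its defining property).  Then colouring the vertex `(d₁, d₂)` of the shift
graph `Γ(D)` by the pair `(δmin d₁ d₂, φ d₁ (δmin d₁ d₂)) ∈ X × {0,1}` is a proper
colouring with at most `|X × {0,1}|` colours; in particular the chromatic number of
`Γ(D)` is at most `|X|`, i.e. `Γ(D)` has a proper colouring with colour set `X`. -/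
theorem stmt19 (X : Type*) [LinearOrder X] [WellFoundedLT X] [Infinite X]
    (D : Type*) [LinearOrder D]
    (φ : D → X → Bool) (hφ : Function.Bijective φ)
    (δmin : D → D → X)
    (hδ : ∀ d₁ d₂ : D, d₁ ≠ d₂ →
      φ d₁ (δmin d₁ d₂) ≠ φ d₂ (δmin d₁ d₂) ∧
      ∀ δ : X, δ < δmin d₁ d₂ → φ d₁ δ = φ d₂ δ) :
    (∀ a b : {p : D × D // p.1 < p.2}, a.val.2 = b.val.1 →
      (δmin a.val.1 a.val.2, φ a.val.1 (δmin a.val.1 a.val.2)) ≠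
        (δmin b.val.1 b.val.2, φ b.val.1 (δmin b.val.1 b.val.2))) ∧
    ∃ c : {p : D × D // p.1 < p.2} → X,
      ∀ a b : {p : D × D // p.1 < p.2}, a.val.2 = b.val.1 → c a ≠ c b := by
  have hproper : ∀ a b : {p : D × D // p.1 < p.2}, a.val.2 = b.val.1 →
      (δmin a.val.1 a.val.2, φ a.val.1 (δmin a.val.1 a.val.2)) ≠
        (δmin b.val.1 b.val.2, φ b.val.1 (δmin b.val.1 b.val.2)) := by
    intro a b hab heq
    obtain ⟨hmin, hval⟩ := Prod.mk.inj heq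
    rw [← hmin, ← hab] at hval
    exact (hδ _ _ a.prop.ne).1 hval
  obtain ⟨e⟩ : Nonempty (X × Bool ≃ X) := by
    rw [← Cardinal.eq, Cardinal.mk_prod, Cardinal.lift_uzero]
    refine Cardinal.mul_eq_left (by simp) ?_ (by simp)
    exact (Cardinal.lift_le_aleph0.2 Cardinal.mk_le_aleph0).trans (Cardinal.aleph0_le_mk X)
  exact ⟨hproper, fun a => e (δmin a.val.1 a.val.2, φ a.val.1 (δmin a.val.1 a.val.2)),
    fun a b hab h => hproper a b hab (e.injective h)⟩
end
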